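/- Let G be a finite group having a normal subgroup S of index 3 such that S is isomorphic to PSL(3,4). Then G does not have trivial intersection Sylow 3-subgroups: there exist two distinct Sylow 3-subgroups of G whose intersection is nontrivial. -/

import Mathlib

instance fact2 : Fact (Nat.Prime 2) := ⟨by norm_num⟩

/-- `PSL(3,4)`: the quotient of `SL(3, GF(4))` by its centre. -/
def PSL34 : Type :=
  Matrix.SpecialLinearGroup (Fin 3) (GaloisField 2 2) ⧸
    Subgroup.center (Matrix.SpecialLinearGroup (Fin 3) (GaloisField 2 2))

noncomputable instance : Group PSL34 :=
  inferInstanceAs (Group (Matrix.SpecialLinearGroup (Fin 3) (GaloisField 2 2) ⧸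
    Subgroup.center (Matrix.SpecialLinearGroup (Fin 3) (GaloisField 2 2))))

/-- If distinct Sylow `p`-subgroups intersect trivially, then their number is congruent to `1` modulo
the order of a Sylow `p`-subgroup. -/
theorem card_sylow_modEq_one_of_inf_eq_bot {p : ℕ} [Fact p.Prime] {G : Type*} [Group G] [Finite G]
    (h : ∀ P Q : Sylow p G, P ≠ Q → (P : Subgroup G) ⊓ (Q : Subgroup G) = ⊥) (P : Sylow p G) :
    Nat.card (Sylow p G) ≡ 1 [MOD Nat.card P] := by
  let X : SubMulAction P (Sylow p G) :=
    { carrier := {Q | Q ≠ P}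
      smul_mem' := by
        intro g Q hQ hgQ
        have hgP : (g : G) • P = P :=
          Sylow.smul_eq_iff_mem_normalizer.mpr (Subgroup.le_normalizer g.2)
        exact hQ (MulAction.injective (g : G) (Eq.trans hgQ hgP.symm)) }
  have hfree (Q : X) : MulAction.stabilizer P Q = ⊥ := by
    rw [eq_bot_iff]
    intro g hg
    have hgQ : (g : G) • (Q : Sylow p G) = Q := congrArg Subtype.val hg
    have hmem : (g : G) ∈ (P : Subgroup G) ⊓ (Q : Subgroup G) := by
      rw [← P.2.inf_normalizer_sylow]
      exact ⟨g.2, Sylow.smul_eq_iff_mem_normalizer.mp hgQ⟩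
    rw [h P Q (Ne.symm Q.2), Subgroup.mem_bot] at hmem
    exact Subgroup.mem_bot.mpr (Subtype.ext hmem)
  have hX : Nat.card P ∣ Nat.card X := by
    rw [Nat.card_congr (MulAction.selfEquivOrbitsQuotientProd hfree), Nat.card_prod]
    exact dvd_mul_left _ _
  have hcard : Nat.card (Sylow p G) = Nat.card X + 1 := by
    have := Set.ncard_add_ncard_compl ({P} : Set (Sylow p G))
    rw [Set.ncard_singleton] at this
    rw [← this, add_comm]
    rfl
  rw [hcard]
  simpa using (Nat.modEq_zero_iff_dvd.mpr hX).add_right 1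

namespace Matrix.SpecialLinearGroup

/-- The upper unitriangular matrices in `SL(3, R)`. -/
def unitriangular (R : Type*) [CommRing R] : Subgroup (SpecialLinearGroup (Fin 3) R) where
  carrier := {M | (M 0 0 = 1 ∧ M 1 1 = 1 ∧ M 2 2 = 1) ∧ M 1 0 = 0 ∧ M 2 0 = 0 ∧ M 2 1 = 0}
  one_mem' := by simp
  mul_mem' := by
    rintro A B ⟨⟨hA, hA', hA''⟩, hA₁, hA₂, hA₃⟩ ⟨⟨hB, hB', hB''⟩, hB₁, hB₂, hB₃⟩
    simp [Matrix.mul_apply, Fin.sum_univ_three, *]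
  inv_mem' := by
    rintro A ⟨⟨hA, hA', hA''⟩, hA₁, hA₂, hA₃⟩
    simp [Matrix.adjugate_fin_three, *]

theorem mem_unitriangular {R : Type*} [CommRing R] {M : SpecialLinearGroup (Fin 3) R} :
    M ∈ unitriangular R ↔
      (M 0 0 = 1 ∧ M 1 1 = 1 ∧ M 2 2 = 1) ∧ M 1 0 = 0 ∧ M 2 0 = 0 ∧ M 2 1 = 0 :=
  Iff.rfl

/-- An upper unitriangular matrix is determined by its entries above the diagonal. -/
def unitriangularEquiv (R : Type*) [CommRing R] : unitriangular R ≃ R × R × R where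
  toFun M := (M.1 0 1, M.1 0 2, M.1 1 2)
  invFun x := ⟨⟨!![1, x.1, x.2.1; 0, 1, x.2.2; 0, 0, 1], by simp [Matrix.det_fin_three]⟩,
    ⟨⟨rfl, rfl, rfl⟩, rfl, rfl, rfl⟩⟩
  left_inv := by
    rintro ⟨M, ⟨h, h', h''⟩, h₁, h₂, h₃⟩
    ext i j
    fin_cases i <;> fin_cases j <;> simp [*]
  right_inv x := by simp

theorem card_unitriangular (R : Type*) [CommRing R] :
    Nat.card (unitriangular R) = Nat.card R ^ 3 := by
  rw [Nat.card_congr (unitriangularEquiv R), Nat.card_prod, Nat.card_prod]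
  ring

/-- The diagonal matrix with entries `1, w, w ^ 2`, for a cube root of unity `w`. -/
def diagPow {R : Type*} [CommRing R] (w : R) (hw : w ^ 3 = 1) : SpecialLinearGroup (Fin 3) R :=
  ⟨!![1, 0, 0; 0, w, 0; 0, 0, w ^ 2], by
    simp only [Matrix.det_fin_three, Matrix.of_apply, Matrix.cons_val]
    linear_combination hw⟩

section diagPow

variable {R : Type*} [CommRing R] {w : R} (hw : w ^ 3 = 1)

@[simp]
theorem coe_diagPow :
    (diagPow w hw : Matrix (Fin 3) (Fin 3) R) = !![1, 0, 0; 0, w, 0; 0, 0, w ^ 2] :=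
  rfl

theorem diagPow_pow_three : diagPow w hw ^ 3 = 1 := by
  have h6 : w ^ 2 * w ^ 2 * w ^ 2 = 1 := by linear_combination (w ^ 3 + 1) * hw
  have h3 : w * w * w = 1 := by linear_combination hw
  rw [pow_succ, pow_two]
  ext i j
  fin_cases i <;> fin_cases j <;> simp [Matrix.mul_apply, Fin.sum_univ_three, h3, h6]

theorem conj_diagPow_mem_unitriangular {M : SpecialLinearGroup (Fin 3) R}
    (hM : M ∈ unitriangular R) : diagPow w hw * M * (diagPow w hw)⁻¹ ∈ unitriangular R := by
  obtain ⟨⟨h, h', h''⟩, h₁, h₂, h₃⟩ := hM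
  have h4 : w * (w * w ^ 2) = w := by linear_combination w * hw
  have h5 : w * w ^ 2 = 1 := by linear_combination hw
  have h6 : w ^ 2 * w = 1 := by linear_combination hw
  simp [mem_unitriangular, Matrix.mul_apply, Matrix.vecMul, dotProduct, Fin.sum_univ_three,
    Matrix.adjugate_fin_three, *]

theorem eq_one_of_commute_diagPow [IsDomain R] (h1 : w ≠ 1) {M : SpecialLinearGroup (Fin 3) R}
    (hM : M ∈ unitriangular R) (hcomm : M * diagPow w hw = diagPow w hw * M) : M = 1 := by
  obtain ⟨⟨h, h', h''⟩, h₁, h₂, h₃⟩ := hM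
  have h0 : w ≠ 0 := by rintro rfl; simp at hw
  have hsub : w - 1 ≠ 0 := sub_ne_zero.mpr h1
  have h2 : w ^ 2 - 1 ≠ 0 := fun h2 => hsub (by linear_combination hw - w * h2)
  have e (i j : Fin 3) := congrArg (fun A : SpecialLinearGroup (Fin 3) R => A i j) hcomm
  have e01 := e 0 1
  have e02 := e 0 2
  have e12 := e 1 2
  simp [Matrix.mul_apply, Fin.sum_univ_three, h, h', h''] at e01 e02 e12
  have z01 : M 0 1 = 0 := (mul_eq_zero_iff_right hsub).mp (by linear_combination e01)
  have z02 : M 0 2 = 0 := (mul_eq_zero_iff_right h2).mp (by linear_combination e02)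
  have z12 : M 1 2 = 0 :=
    (mul_eq_zero_iff_right (mul_ne_zero h0 hsub)).mp (by linear_combination e12)
  ext i j
  fin_cases i <;> fin_cases j <;> simp [*]

end diagPow

theorem unitriangular_inf_center (R : Type*) [CommRing R] :
    unitriangular R ⊓ Subgroup.center (SpecialLinearGroup (Fin 3) R) = ⊥ := by
  rw [eq_bot_iff]
  rintro M ⟨⟨⟨h, -⟩, -⟩, hc⟩
  have := scalar_eq_self_of_mem_center hc 0
  rw [Subgroup.mem_bot]
  apply Subtype.ext
  rw [← this, h, map_one]
  rfl

theorem card_mul_card_units (n : ℕ) [NeZero n] (F : Type*) [Field F] :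
    Nat.card (SpecialLinearGroup (Fin n) F) * Nat.card Fˣ = Nat.card (GL (Fin n) F) := by
  let f : GL (Fin n) F →* Fˣ := Matrix.GeneralLinearGroup.det
  have hf : f.range = ⊤ := MonoidHom.range_eq_top.mpr GeneralLinearGroup.det_surjective
  have hker : f.ker = (toGL : SpecialLinearGroup (Fin n) F →* GL (Fin n) F).range := by
    ext A
    refine ⟨fun hA => ⟨⟨A, congrArg Units.val hA⟩, Units.ext rfl⟩, ?_⟩
    rintro ⟨B, rfl⟩
    exact Units.ext B.2
  rw [← f.ker.card_mul_index, Subgroup.index_ker, hf, Subgroup.card_top, hker,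
    Nat.card_congr (MonoidHom.ofInjective toGL_injective).toEquiv]

theorem card_fin_three_of_card_eq_four {F : Type*} [Field F] (hF : Nat.card F = 4) :
    Nat.card (SpecialLinearGroup (Fin 3) F) = 60480 := by
  have : Finite F := Nat.finite_of_card_ne_zero (by omega)
  have := Fintype.ofFinite F
  have hGL := card_mul_card_units 3 F
  have hF' : Fintype.card F = 4 := by rw [← Nat.card_eq_fintype_card, hF]
  rw [card_GL_field, Nat.card_units, hF, hF'] at hGL
  simp [Fin.prod_univ_three] at hGL
  omega

theorem card_center_fin_three_of_card_eq_four {F : Type*} [Field F] (hF : Nat.card F = 4) :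
    Nat.card (Subgroup.center (SpecialLinearGroup (Fin 3) F)) = 3 := by
  have : Finite F := Nat.finite_of_card_ne_zero (by omega)
  rw [Nat.card_congr (center_equiv_rootsOfUnity' (0 : Fin 3)).toEquiv, Fintype.card_fin]
  have : rootsOfUnity 3 F = ⊤ := by
    rw [eq_top_iff]
    intro x _
    rw [mem_rootsOfUnity]
    have := pow_card_eq_one' (x := x)
    rwa [Nat.card_units, hF] at this
  rw [this, Subgroup.card_top, Nat.card_units, hF]

end Matrix.SpecialLinearGroup

open Matrix.SpecialLinearGroup

/-- If `SL(3, F)` maps to `G` with central kernel and `F` has a cube root of unity `w ≠ 1`, then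
`G` has at least `|F| ^ 3` Sylow `3`-subgroups, provided that `|F|` is coprime to `3`. -/
theorem card_pow_three_le_card_sylow {F G : Type*} [Field F] [Finite F] [Group G] [Finite G]
    (φ : Matrix.SpecialLinearGroup (Fin 3) F →* G)
    (hφ : φ.ker ≤ Subgroup.center (Matrix.SpecialLinearGroup (Fin 3) F))
    (hF : (Nat.card F).Coprime 3) {w : F} (hw : w ^ 3 = 1) (hw1 : w ≠ 1) :
    Nat.card F ^ 3 ≤ Nat.card (Sylow 3 G) := by
  set d := diagPow w hw
  have hd : IsPGroup 3 (Subgroup.zpowers (φ d)) := by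
    refine IsPGroup.of_card_dvd_pow (n := 1) ?_
    rw [Nat.card_zpowers, pow_one]
    exact orderOf_dvd_of_pow_eq_one (by rw [← map_pow, diagPow_pow_three, map_one])
  obtain ⟨P, hP⟩ := hd.exists_le_sylow
  have hdP : φ d ∈ P := hP (Subgroup.mem_zpowers _)
  rw [← card_unitriangular]
  refine Nat.card_le_card_of_injective (fun u : unitriangular F => φ u • P) fun u v huv => ?_
  have hmem : v⁻¹ * u = 1 := by
    set k := v⁻¹ * u with hk
    have hkP : φ k • P = P := by
      simp only at huv
      simp [hk, mul_smul, huv]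
    have hconj : φ k * φ d * (φ k)⁻¹ ∈ P :=
      (Subgroup.mem_normalizer_iff.mp (Sylow.smul_eq_iff_mem_normalizer.mp hkP) _).mp hdP
    set x := k * (d * (k : Matrix.SpecialLinearGroup (Fin 3) F)⁻¹ * d⁻¹) with hx
    have hxU : x ∈ unitriangular F :=
      mul_mem k.2 (conj_diagPow_mem_unitriangular hw (inv_mem k.2))
    have hxP : φ x ∈ P := by
      have : φ x = φ k * φ d * (φ k)⁻¹ * (φ d)⁻¹ := by simp [hx, mul_assoc]
      rw [this]
      exact mul_mem hconj (inv_mem hdP)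
    have hx1 : φ x = 1 := by
      obtain ⟨n, hn⟩ := P.2 ⟨φ x, hxP⟩
      have hn' : φ x ^ 3 ^ n = 1 := congrArg Subtype.val hn
      have hm : φ x ^ (Nat.card F ^ 3) = 1 := by
        have := congrArg Subtype.val (pow_card_eq_one' (x := (⟨x, hxU⟩ : unitriangular F)))
        rw [card_unitriangular] at this
        rw [← map_pow]
        simpa using congrArg φ this
      have hcop : (Nat.card F ^ 3).Coprime (3 ^ n) := hF.pow _ _
      exact orderOf_eq_one_iff.mp <| Nat.eq_one_of_dvd_coprimes hcop
        (orderOf_dvd_of_pow_eq_one hm) (orderOf_dvd_of_pow_eq_one hn')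
    have hx' : x = 1 := by
      rw [← Subgroup.mem_bot, ← unitriangular_inf_center]
      exact ⟨hxU, hφ hx1⟩
    refine Subtype.ext (eq_one_of_commute_diagPow hw hw1 k.2 ?_)
    rw [hx] at hx'
    have := congrArg (· * d * (k : Matrix.SpecialLinearGroup (Fin 3) F)) hx'
    simpa [mul_assoc] using this
  exact (inv_mul_eq_one.mp hmem).symm

/-- If a finite group `G` has a normal subgroup `S` of index 3 with `S ≅ PSL(3,4)`,
then `G` does not have trivial intersection Sylow 3-subgroups: there are two distinct
Sylow 3-subgroups of `G` with nontrivial intersection. -/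
theorem psl34_extension_not_TI (G : Type) [Group G] [Finite G]
    (S : Subgroup G) [S.Normal] (hidx : S.index = 3)
    (hiso : Nonempty (S ≃* PSL34)) :
    ∃ P Q : Sylow 3 G, P ≠ Q ∧ (P : Subgroup G) ⊓ (Q : Subgroup G) ≠ ⊥ := by
  by_contra! hTI
  let F := GaloisField 2 2
  have hF : Nat.card F = 4 := GaloisField.card 2 2 two_ne_zero
  have : Finite F := Nat.finite_of_card_ne_zero (by omega)
  obtain ⟨e⟩ := hiso
  let π : Matrix.SpecialLinearGroup (Fin 3) F →* PSL34 := QuotientGroup.mk' _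
  let φ : Matrix.SpecialLinearGroup (Fin 3) F →* G := S.subtype.comp (e.symm.toMonoidHom.comp π)
  have hφ : φ.ker ≤ Subgroup.center (Matrix.SpecialLinearGroup (Fin 3) F) := by
    intro x hx
    have hπ : π x = 1 := by simpa [φ] using hx
    exact (QuotientGroup.eq_one_iff x).mp hπ
  have hPSL : Nat.card PSL34 * 3 = 60480 := by
    have := Subgroup.card_eq_card_quotient_mul_card_subgroup
      (Subgroup.center (Matrix.SpecialLinearGroup (Fin 3) F))
    rw [card_fin_three_of_card_eq_four hF, card_center_fin_three_of_card_eq_four hF] at this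
    exact this.symm
  have hG : Nat.card G = 60480 := by
    rw [← S.card_mul_index, hidx, Nat.card_congr e.toEquiv, hPSL]
  obtain ⟨w, hw0, hw1⟩ : ∃ w : F, w ≠ 0 ∧ w ≠ 1 := by
    by_contra! h
    have hsub : (Set.univ : Set F) ⊆ {0, 1} := fun w _ => or_iff_not_imp_left.mpr (h w)
    have := (Set.ncard_le_ncard hsub).trans (Set.ncard_insert_le _ _)
    rw [Set.ncard_univ, hF, Set.ncard_singleton] at this
    omega
  have hw : w ^ 3 = 1 := by
    have := Fintype.ofFinite F
    have := FiniteField.pow_card_sub_one_eq_one w hw0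
    rwa [← Nat.card_eq_fintype_card, hF] at this
  have hle := card_pow_three_le_card_sylow φ hφ (by rw [hF]; norm_num) hw hw1
  let P : Sylow 3 G := default
  have hP : Nat.card P = 27 := by
    have h : (60480 : ℕ).factorization 3 = 3 := by
      rw [show 60480 = 3 ^ 3 * 2240 by norm_num, Nat.factorization_mul (by norm_num) (by norm_num),
        Nat.prime_three.factorization_pow, Finsupp.add_apply, Finsupp.single_eq_same,
        Nat.factorization_eq_zero_of_not_dvd (by norm_num)]
    norm_num [P.card_eq_multiplicity, hG, h]
  have hdvd : Nat.card (Sylow 3 G) ∣ 2240 := by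
    have h1 := P.card_dvd_index
    have h2 := (P : Subgroup G).card_mul_index
    have h3 : (P : Subgroup G).index = 2240 := by
      rw [hG, hP] at h2
      omega
    rwa [h3] at h1
  have hmod := card_sylow_modEq_one_of_inf_eq_bot hTI P
  rw [hP] at hmod
  rw [hF] at hle
  have key : ∀ n ∈ Nat.divisors 2240, 64 ≤ n → ¬ n ≡ 1 [MOD 27] := by decide +kernel
  exact key _ (Nat.mem_divisors.mpr ⟨hdvd, by norm_num⟩) hle hmod
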